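/- For every j ≥ 1 the polynomial of the first kind is given by the determinant formula P_j(λ) = (b_0 b_1 ⋯ b_{j−1})^{−1} det(λ·I − H_{[0,j−1]}). -/

import Mathlib

open Polynomial

/-- Polynomials of the first kind: `P_0 = 1`, `P_1 = p_0 / b_0`, and
`b_{j+1} P_{j+2} = p_{j+1} P_{j+1} - ε_j ε_{j+1} b_j P_j`. -/
noncomputable def genP (ε b : ℕ → ℝ) (p : ℕ → Polynomial ℝ) : ℕ → Polynomial ℝ
  | 0 => 1
  | 1 => Polynomial.C (b 0)⁻¹ * p 0
  | (j + 2) => Polynomial.C (b (j + 1))⁻¹ *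
      (p (j + 1) * genP ε b p (j + 1) -
        Polynomial.C (ε j * ε (j + 1) * b j) * genP ε b p j)

/-- Polynomials of the second kind: `Q_0 = 0`, `Q_1 = ε_0 / b_0`, same recurrence. -/
noncomputable def genQ (ε b : ℕ → ℝ) (p : ℕ → Polynomial ℝ) : ℕ → Polynomial ℝ
  | 0 => 0
  | 1 => Polynomial.C (ε 0 / b 0)
  | (j + 2) => Polynomial.C (b (j + 1))⁻¹ *
      (p (j + 1) * genQ ε b p (j + 1) -
        Polynomial.C (ε j * ε (j + 1) * b j) * genQ ε b p j)

/-- `nsum k j = n_j = k_0 + ⋯ + k_{j-1}`. -/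
def nsum (k : ℕ → ℕ) (j : ℕ) : ℕ := ∑ i ∈ Finset.range j, k i

/-- The index `i` of the block containing the global row/column index `r`,
i.e. the greatest `i` with `n_i ≤ r` (assuming all `k i ≥ 1`). -/
def blkIdx (k : ℕ → ℕ) (r : ℕ) : ℕ := Nat.findGreatest (fun i => nsum k i ≤ r) r

/-- Entry of the (infinite) generalized Jacobi matrix at global position `(r, c)`:
diagonal blocks are companion matrices `C_{p_i}`, subdiagonal blocks `B_i` have the
single nonzero entry `b_i` in the top-right corner, superdiagonal blocks `B̃_i` have
the single nonzero entry `ε_i ε_{i+1} b_i` in the top-right corner. -/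
noncomputable def Jentry (ε b : ℕ → ℝ) (p : ℕ → Polynomial ℝ) (k : ℕ → ℕ) (r c : ℕ) : ℝ :=
  let i := blkIdx k r
  let i' := blkIdx k c
  let a := r - nsum k i
  let a' := c - nsum k i'
  if i = i' then
    (if a' = k i - 1 then -((p i).coeff a) else if a = a' + 1 then 1 else 0)
  else if i = i' + 1 then
    (if a = 0 ∧ a' = k i' - 1 then b i' else 0)
  else if i' = i + 1 then
    (if a = 0 ∧ a' = k i' - 1 then ε i * ε i' * b i else 0)
  else 0

/-- The finite generalized Jacobi matrix built from the blocks indexed `0, …, m-1`;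
it has size `n_m × n_m`.  Thus `H_{[0,j]} = JmatN ε b p k (j+1)`. -/
noncomputable def JmatN (ε b : ℕ → ℝ) (p : ℕ → Polynomial ℝ) (k : ℕ → ℕ) (m : ℕ) :
    Matrix (Fin (nsum k m)) (Fin (nsum k m)) ℝ :=
  Matrix.of fun r c => Jentry ε b p k (r : ℕ) (c : ℕ)

/-- If a row vector `v` with `v 0 = 1` sends an upper Hessenberg matrix to a multiple `q` of the last
basis vector, then the determinant is `q` times the signed product of the subdiagonal entries. -/
theorem Matrix.det_of_upperHessenberg {R : Type*} [CommRing R] (n : ℕ) (M : ℕ → ℕ → R) (v : ℕ → R)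
    (q : R) (hv : v 0 = 1) (hM : ∀ r c, c + 1 < r → M r c = 0)
    (hvM : ∀ c ≤ n, ∑ r ∈ Finset.range (n + 1), v r * M r c = if c = n then q else 0) :
    (Matrix.of fun r c : Fin (n + 1) => M r c).det =
      q * ((-1) ^ n * ∏ t ∈ Finset.range n, M (t + 1) t) := by
  set A : Matrix (Fin (n + 1)) (Fin (n + 1)) R := Matrix.of fun r c => M r c with hA
  have hvA : Matrix.vecMul (fun r : Fin (n + 1) => v r) A = Pi.single (Fin.last n) q := by
    ext c
    have h := hvM c (Nat.lt_succ_iff.mp c.2)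
    rw [Finset.sum_range] at h
    simp only [Matrix.vecMul, dotProduct, hA, Matrix.of_apply, h, Pi.single_apply, Fin.ext_iff,
      Fin.val_last]
  have hadj : A.adjugate (Fin.last n) 0 = (-1) ^ n * ∏ t ∈ Finset.range n, M (t + 1) t := by
    rw [Matrix.adjugate_fin_succ_eq_det_submatrix, Matrix.det_of_isUpperTriangular]
    · simp [hA, Finset.prod_range]
    · intro r c hrc
      have hrc' : (c : ℕ) < r := hrc
      simpa [hA] using hM (r + 1) c (by omega)
  have h := congrFun (congrArg (fun w => Matrix.vecMul w A.adjugate) hvA) 0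
  simpa [Matrix.vecMul_vecMul, Matrix.mul_adjugate, Matrix.vecMul_smul, hv, hadj] using h

theorem nsum_succ (k : ℕ → ℕ) (i : ℕ) : nsum k (i + 1) = nsum k i + k i :=
  Finset.sum_range_succ _ _

theorem nsum_mono (k : ℕ → ℕ) : Monotone (nsum k) :=
  monotone_nat_of_le_succ fun i => by rw [nsum_succ]; omega

theorem le_nsum {k : ℕ → ℕ} (hk : ∀ j, 1 ≤ k j) (i : ℕ) : i ≤ nsum k i := by
  induction i with
  | zero => simp
  | succ i ih => have := hk i; rw [nsum_succ]; omega

theorem blkIdx_nsum_add {k : ℕ → ℕ} (hk : ∀ j, 1 ≤ k j) {i a : ℕ} (ha : a < k i) :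
    blkIdx k (nsum k i + a) = i := by
  rw [blkIdx, Nat.findGreatest_eq_iff]
  refine ⟨(le_nsum hk i).trans (Nat.le_add_right _ _), fun _ => Nat.le_add_right _ _, ?_⟩
  intro l hl _ hle
  have := nsum_mono k (Nat.succ_le_of_lt hl)
  rw [Nat.succ_eq_add_one, nsum_succ] at this
  omega

theorem exists_eq_nsum_add (k : ℕ → ℕ) (m r : ℕ) (hr : r < nsum k m) :
    ∃ i a, i < m ∧ a < k i ∧ r = nsum k i + a := by
  induction m with
  | zero => simp [nsum] at hr
  | succ m ih =>
    rcases lt_or_ge r (nsum k m) with h | h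
    · obtain ⟨i, a, hi, ha, rfl⟩ := ih h
      exact ⟨i, a, hi.trans (Nat.lt_succ_self m), ha, rfl⟩
    · rw [nsum_succ] at hr
      exact ⟨m, r - nsum k m, Nat.lt_succ_self m, by omega, by omega⟩

theorem sum_range_nsum {R : Type*} [AddCommMonoid R] (k : ℕ → ℕ) (f : ℕ → R) (m : ℕ) :
    ∑ r ∈ Finset.range (nsum k m), f r =
      ∑ i ∈ Finset.range m, ∑ a ∈ Finset.range (k i), f (nsum k i + a) := by
  induction m with
  | zero => simp [nsum]
  | succ m ih => rw [nsum_succ, Finset.sum_range_add, ih, Finset.sum_range_succ]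

theorem Jentry_nsum_add (ε b : ℕ → ℝ) (p : ℕ → ℝ[X]) {k : ℕ → ℕ} (hk : ∀ j, 1 ≤ k j)
    {i a i' a' : ℕ} (ha : a < k i) (ha' : a' < k i') :
    Jentry ε b p k (nsum k i + a) (nsum k i' + a') =
      if i = i' then
        (if a' = k i - 1 then -((p i).coeff a) else if a = a' + 1 then 1 else 0)
      else if i = i' + 1 then
        (if a = 0 ∧ a' = k i' - 1 then b i' else 0)
      else if i' = i + 1 then
        (if a = 0 ∧ a' = k i' - 1 then ε i * ε i' * b i else 0)
      else 0 := by
  simp only [Jentry, blkIdx_nsum_add hk ha, blkIdx_nsum_add hk ha', Nat.add_sub_cancel_left]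

theorem Jentry_eq_zero (ε b : ℕ → ℝ) (p : ℕ → ℝ[X]) {k : ℕ → ℕ} (hk : ∀ j, 1 ≤ k j)
    {r c : ℕ} (h : c + 1 < r) : Jentry ε b p k r c = 0 := by
  obtain ⟨i, a, -, ha, rfl⟩ := exists_eq_nsum_add k (r + 1) r (le_nsum hk _)
  obtain ⟨i', a', -, ha', rfl⟩ := exists_eq_nsum_add k (c + 1) c (le_nsum hk _)
  rw [Jentry_nsum_add ε b p hk ha ha']
  split_ifs with h₁ h₂ h₃ h₄ h₅ h₆ h₇
  · subst h₁; omega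
  · subst h₁; omega
  · rfl
  · subst h₄; rw [nsum_succ] at h; omega
  · rfl
  · subst h₆; rw [nsum_succ] at h; omega
  · rfl
  · rfl

theorem Jentry_succ_self (ε b : ℕ → ℝ) (p : ℕ → ℝ[X]) {k : ℕ → ℕ} (hk : ∀ j, 1 ≤ k j)
    {i a : ℕ} (ha : a < k i) :
    Jentry ε b p k (nsum k i + a + 1) (nsum k i + a) = if a = k i - 1 then b i else 1 := by
  split_ifs with h
  · have h₁ : nsum k i + a + 1 = nsum k (i + 1) + 0 := by rw [nsum_succ]; omega
    rw [h₁, Jentry_nsum_add ε b p hk (hk _) ha]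
    simp [h]
  · rw [add_assoc, Jentry_nsum_add ε b p hk (by omega) ha]
    simp [h]

theorem prod_Jentry_succ_self (ε b : ℕ → ℝ) (p : ℕ → ℝ[X]) {k : ℕ → ℕ} (hk : ∀ j, 1 ≤ k j)
    (m : ℕ) :
    ∏ t ∈ Finset.range (nsum k m), Jentry ε b p k (t + 1) t = ∏ i ∈ Finset.range m, b i := by
  induction m with
  | zero => simp [nsum]
  | succ m ih =>
    rw [nsum_succ, Finset.prod_range_add, ih, Finset.prod_range_succ]
    congr 1
    rw [Finset.prod_congr rfl fun a ha =>
      Jentry_succ_self ε b p hk (Finset.mem_range.mp ha), Finset.prod_ite_eq', if_pos]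
    have := hk m
    simp; omega

theorem genP_recurrence (ε : ℕ → ℝ) {b : ℕ → ℝ} (p : ℕ → ℝ[X]) (hb : ∀ j, b j ≠ 0) (i : ℕ) :
    p i * genP ε b p i = C (b i) * genP ε b p (i + 1) +
      ∑ l ∈ Finset.range i, if i = l + 1 then C (ε l * ε i * b l) * genP ε b p l else 0 := by
  have hC : ∀ j, C (b j) * C (b j)⁻¹ = (1 : ℝ[X]) := fun j => by
    rw [← C_mul, mul_inv_cancel₀ (hb j), C_1]
  cases i with
  | zero => simp [genP, ← mul_assoc, hC]
  | succ i =>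
    simp only [Nat.add_right_cancel_iff, Finset.sum_ite_eq, Finset.mem_range, Nat.lt_succ_self,
      if_true]
    rw [genP, ← mul_assoc (C (b (i + 1))), hC]
    ring

/-- The combination of the rows in block `i` of the generalized Jacobi matrix with weights `X ^ a`,
read off at column `a'` of block `i'`. -/
theorem sum_X_pow_mul_Jentry (ε b : ℕ → ℝ) {p : ℕ → ℝ[X]} {k : ℕ → ℕ} (hp : ∀ j, (p j).Monic)
    (hdeg : ∀ j, (p j).natDegree = k j) (hk : ∀ j, 1 ≤ k j) {i i' a' : ℕ} (ha' : a' < k i') :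
    ∑ a ∈ Finset.range (k i), X ^ a * C (Jentry ε b p k (nsum k i + a) (nsum k i' + a')) =
      (if i = i' then X ^ (a' + 1) - (if a' = k i' - 1 then p i' else 0) else 0) +
      (if i = i' + 1 then (if a' = k i' - 1 then C (b i') else 0) else 0) +
      (if i' = i + 1 then (if a' = k i' - 1 then C (ε i * ε i' * b i) else 0) else 0) := by
  rw [Finset.sum_congr rfl fun a ha => by
    rw [Jentry_nsum_add ε b p hk (Finset.mem_range.mp ha) ha']]
  have hcorner : ∀ x : ℝ, ∑ a ∈ Finset.range (k i),
      (X : ℝ[X]) ^ a * C (if a = 0 ∧ a' = k i' - 1 then x else 0) =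
        if a' = k i' - 1 then C x else 0 := by
    intro x
    rw [Finset.sum_eq_single_of_mem 0 (Finset.mem_range.mpr (hk i))]
    · split_ifs <;> simp_all
    · intro a _ ha
      simp [ha]
  by_cases h₁ : i = i'
  · subst h₁
    by_cases h : a' = k i - 1
    · have hpi := (hp i).as_sum
      rw [hdeg] at hpi
      have h' : a' + 1 = k i := by omega
      simp only [if_pos h, if_true, show i ≠ i + 1 by omega, if_false, add_zero]
      simp only [C_neg, h', mul_comm (X ^ _), neg_mul, Finset.sum_neg_distrib]
      linear_combination hpi
    · simp only [h, if_true, if_false]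
      rw [Finset.sum_eq_single_of_mem (a' + 1) (Finset.mem_range.mpr (by omega))]
      · simp
      · intro a _ ha
        simp [ha]
  · by_cases h₂ : i = i' + 1
    · have h₃ : i' ≠ i + 1 := by omega
      simp only [if_neg h₁, if_pos h₂, if_neg h₃, zero_add, add_zero]
      exact hcorner _
    · by_cases h₃ : i' = i + 1
      · simp only [if_neg h₁, if_neg h₂, if_pos h₃, zero_add]
        exact hcorner _
      · simp [h₁, h₂, h₃]

/-- The row vector `(X ^ a * P_i)`, indexed by the position `a` in block `i`, is a left eigenvector
of the finite generalized Jacobi matrix for the eigenvalue `X`, up to the last column. -/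
theorem sum_X_pow_mul_genP_mul_Jentry (ε : ℕ → ℝ) {b : ℕ → ℝ} {p : ℕ → ℝ[X]} {k : ℕ → ℕ}
    (hb : ∀ j, b j ≠ 0) (hp : ∀ j, (p j).Monic) (hdeg : ∀ j, (p j).natDegree = k j)
    (hk : ∀ j, 1 ≤ k j) {m i' a' : ℕ} (hi' : i' < m) (ha' : a' < k i') :
    ∑ i ∈ Finset.range m, genP ε b p i *
      ∑ a ∈ Finset.range (k i), X ^ a * C (Jentry ε b p k (nsum k i + a) (nsum k i' + a')) =
      X ^ (a' + 1) * genP ε b p i' -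
        if i' + 1 = m ∧ a' = k i' - 1 then C (b i') * genP ε b p m else 0 := by
  simp only [sum_X_pow_mul_Jentry ε b hp hdeg hk ha', mul_add, Finset.sum_add_distrib, mul_ite,
    mul_zero, Finset.sum_ite_eq', Finset.mem_range, hi', if_true]
  by_cases h : a' = k i' - 1
  · have hsum : ∑ l ∈ Finset.range m,
        (if i' = l + 1 then genP ε b p l * C (ε l * ε i' * b l) else 0) =
        ∑ l ∈ Finset.range i',
        (if i' = l + 1 then C (ε l * ε i' * b l) * genP ε b p l else 0) := by
      symm
      simp only [mul_comm (C _)]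
      apply Finset.sum_subset
      · intro l hl
        simp only [Finset.mem_range] at hl ⊢
        omega
      · intro l _ hl
        rw [if_neg]
        simp only [Finset.mem_range] at hl
        omega
    have hrec := genP_recurrence ε p hb i'
    rw [← hsum] at hrec
    simp only [← h, and_true, if_true]
    rcases eq_or_ne (i' + 1) m with hm | hm
    · subst hm
      simp only [lt_irrefl, if_true, if_false]
      linear_combination -hrec
    · have hm' : i' + 1 < m := by omega
      simp only [hm, hm', if_true, if_false]
      linear_combination -hrec
  · simp [h, mul_comm]

theorem charpoly_JmatN_succ (ε : ℕ → ℝ) {b : ℕ → ℝ} {p : ℕ → ℝ[X]} {k : ℕ → ℕ}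
    (hb : ∀ j, b j ≠ 0) (hp : ∀ j, (p j).Monic) (hdeg : ∀ j, (p j).natDegree = k j)
    (hk : ∀ j, 1 ≤ k j) (m : ℕ) :
    (JmatN ε b p k (m + 1)).charpoly =
      C (∏ i ∈ Finset.range (m + 1), b i) * genP ε b p (m + 1) := by
  obtain ⟨n, hn⟩ : ∃ n, nsum k (m + 1) = n + 1 :=
    ⟨nsum k (m + 1) - 1, by have := le_nsum hk (m + 1); omega⟩
  have hkm := hk m
  have hn' : n = nsum k m + (k m - 1) := by rw [nsum_succ] at hn; omega
  let M : ℕ → ℕ → ℝ[X] := fun r c => (if r = c then X else 0) - C (Jentry ε b p k r c)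
  let v : ℕ → ℝ[X] := fun r => X ^ (r - nsum k (blkIdx k r)) * genP ε b p (blkIdx k r)
  have hv : ∀ {i a}, a < k i → v (nsum k i + a) = X ^ a * genP ε b p i := fun ha => by
    simp only [v, blkIdx_nsum_add hk ha, Nat.add_sub_cancel_left]
  have hdet := Matrix.det_of_upperHessenberg n M v (C (b m) * genP ε b p (m + 1))
    (by simpa [nsum, genP] using hv (i := 0) (a := 0) (hk 0))
    (fun r c h => by simp [M, Jentry_eq_zero ε b p hk h, show r ≠ c by omega])
    (fun c hc => by
      obtain ⟨i', a', hi', ha', rfl⟩ := exists_eq_nsum_add k (m + 1) c (by omega)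
      have hlast : nsum k i' + a' = n ↔ i' + 1 = m + 1 ∧ a' = k i' - 1 := by
        constructor
        · intro h
          have him : i' = m := by
            by_contra hne
            have := nsum_mono k (show i' + 1 ≤ m by omega)
            rw [nsum_succ] at this
            omega
          subst him
          omega
        · rintro ⟨h₁, h₂⟩
          obtain rfl : i' = m := by omega
          omega
      have hsum := sum_X_pow_mul_genP_mul_Jentry ε hb hp hdeg hk hi' ha'
      have hJ : ∑ r ∈ Finset.range (n + 1), v r * C (Jentry ε b p k r (nsum k i' + a')) =
          X ^ (a' + 1) * genP ε b p i' -
            if nsum k i' + a' = n then C (b m) * genP ε b p (m + 1) else 0 := by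
        rw [← hn, sum_range_nsum]
        simp only [hlast]
        trans X ^ (a' + 1) * genP ε b p i' -
          if i' + 1 = m + 1 ∧ a' = k i' - 1 then C (b i') * genP ε b p (m + 1) else 0
        · rw [← hsum]
          refine Finset.sum_congr rfl fun i _ => ?_
          rw [Finset.mul_sum]
          refine Finset.sum_congr rfl fun a ha => ?_
          rw [hv (Finset.mem_range.mp ha)]
          ring
        · congr 1
          split_ifs with h
          · rw [Nat.succ_injective h.1]
          · rfl
      simp only [M, mul_sub, Finset.sum_sub_distrib, hJ, mul_ite, mul_zero, Finset.sum_ite_eq',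
        Finset.mem_range, Nat.lt_succ_of_le hc, if_true, hv ha']
      ring)
  have hprod : ∏ t ∈ Finset.range n, M (t + 1) t =
      (-1) ^ n * C (∏ t ∈ Finset.range n, Jentry ε b p k (t + 1) t) := by
    simp [M, Finset.prod_neg]
  have hb' : (∏ t ∈ Finset.range n, Jentry ε b p k (t + 1) t) * b m =
      ∏ i ∈ Finset.range (m + 1), b i := by
    rw [← prod_Jentry_succ_self ε b p hk, hn, Finset.prod_range_succ]
    congr 1
    rw [hn', Jentry_succ_self ε b p hk (by omega), if_pos rfl]
  have hchar : (JmatN ε b p k (m + 1)).charpoly =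
      (Matrix.of fun r c : Fin (n + 1) => M r c).det := by
    rw [← hn]
    refine congrArg Matrix.det (Matrix.ext fun r c => ?_)
    simp [M, Matrix.charmatrix_apply, Matrix.diagonal_apply, JmatN, Fin.ext_iff]
  rw [hchar, hdet, hprod, ← hb', C_mul, ← mul_assoc ((-1) ^ n), ← mul_pow]
  simp only [mul_neg, mul_one, neg_neg, one_pow, one_mul]
  ring

/-- Determinant formula for the polynomials of the first kind: for every `j ≥ 1`,
`P_j(λ) = (b_0 ⋯ b_{j-1})⁻¹ · det(λ·I − H_{[0,j-1]})`, where
`H_{[0,j-1]} = JmatN ε b p k j` and `det(λ·I − ·)` is the characteristic polynomial. -/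
theorem genP_eq_charpoly (ε b : ℕ → ℝ) (p : ℕ → Polynomial ℝ) (k : ℕ → ℕ)
    (hε : ∀ j, ε j = 1 ∨ ε j = -1) (hb : ∀ j, 0 < b j)
    (hp : ∀ j, (p j).Monic) (hdeg : ∀ j, (p j).natDegree = k j) (hk : ∀ j, 1 ≤ k j) :
    ∀ j : ℕ, 1 ≤ j →
      genP ε b p j =
        Polynomial.C (∏ i ∈ Finset.range j, b i)⁻¹ * (JmatN ε b p k j).charpoly := by
  intro j hj
  obtain ⟨m, rfl⟩ := Nat.exists_eq_add_of_le' hj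
  have hb' : ∀ j, b j ≠ 0 := fun j => (hb j).ne'
  rw [charpoly_JmatN_succ ε hb' hp hdeg hk, ← mul_assoc, ← C_mul,
    inv_mul_cancel₀ (Finset.prod_ne_zero_iff.mpr fun i _ => hb' i), C_1, one_mul]
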